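/- Let n, r, e be integers with n ≥ r ≥ 4 and t_{r−1}(n) < e ≤ C(n,2). Then every graph G in the family H_2*(n,e) satisfies N(K_r, G) = h_r*(n,e). -/

import Mathlib

/-- Number of edges of a (simple) graph. -/
noncomputable def edgeCnt {V : Type*} (G : SimpleGraph V) : ℕ := G.edgeSet.ncard

/-- `NK G r` is the number of `r`-cliques in `G`. -/
noncomputable def NK {V : Type*} (G : SimpleGraph V) (r : ℕ) : ℕ :=
  {s : Finset V | G.IsNClique r s}.ncard

/-- Clique count with an integer index: `N(K_r, G) = 0` for `r < 0`. -/
noncomputable def NKZ {V : Type*} (G : SimpleGraph V) (r : ℤ) : ℕ :=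
  if r < 0 then 0 else NK G r.toNat

/-- `tur s n` is the number of edges of the Turán graph `T_s(n)`. -/
noncomputable def tur (s n : ℕ) : ℕ := edgeCnt (SimpleGraph.turanGraph n s)

/-- `kk n e = k(n,e)`, the least `s ≥ 1` with `t_s(n) ≥ e`. -/
noncomputable def kk (n e : ℕ) : ℕ := sInf {s : ℕ | 1 ≤ s ∧ e ≤ tur s n}

/-- `a_k*(n,e)`, the least `a ≥ 1` with `a(n-a) + t_{k-1}(n-a) ≥ e`. -/
noncomputable def aLast (n e : ℕ) : ℕ :=
  sInf {a : ℕ | 1 ≤ a ∧ e ≤ a * (n - a) + tur (kk n e - 1) (n - a)}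

/-- `aStar n e i = a_i*(n,e)` for `i ∈ [k]` (1-indexed):
the unique vector with `a_k* = aLast n e`, `a_1* + ⋯ + a_{k-1}* = n - a_k*` and
`a_1* ≥ ⋯ ≥ a_{k-1}* ≥ a_1* - 1`. -/
noncomputable def aStar (n e i : ℕ) : ℕ :=
  if i = kk n e then aLast n e
  else (n - aLast n e) / (kk n e - 1) +
    (if i ≤ (n - aLast n e) % (kk n e - 1) then 1 else 0)

/-- `m*(n,e) = Σ_{i<j} a_i* a_j* - e` (as a natural number). -/
noncomputable def mStar (n e : ℕ) : ℕ :=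
  (∑ p ∈ (Finset.Icc 1 (kk n e)).powersetCard 2, ∏ i ∈ p, aStar n e i) - e

/-- `m*(n,e) = Σ_{i<j} a_i* a_j* - e` (as an integer). -/
noncomputable def mStarZ (n e : ℕ) : ℤ :=
  (∑ p ∈ (Finset.Icc 1 (kk n e)).powersetCard 2, ∏ i ∈ p, (aStar n e i : ℤ)) - (e : ℤ)

/-- `h_r*(n,e) = Σ_{I ⊆ [k], |I|=r} Π_{i∈I} a_i* - m* Σ_{I' ⊆ [k-2], |I'|=r-2} Π_{j∈I'} a_j*`. -/
noncomputable def hStar (n e r : ℕ) : ℤ :=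
  (∑ I ∈ (Finset.Icc 1 (kk n e)).powersetCard r, ∏ i ∈ I, (aStar n e i : ℤ)) -
    (mStar n e : ℤ) *
      ∑ I ∈ (Finset.Icc 1 (kk n e - 2)).powersetCard (r - 2), ∏ i ∈ I, (aStar n e i : ℤ)

/-- Membership in the family `K(n,e)`: `(n,e)`-graphs obtained from a complete multipartite
graph by adding a triangle-free graph into one part. -/
def MemK (n e : ℕ) (G : SimpleGraph (Fin n)) : Prop :=
  edgeCnt G = e ∧
  ∃ (c : Fin n → ℕ) (j₀ : ℕ),
    (∀ u v, c u ≠ c v → G.Adj u v) ∧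
    (∀ u v, G.Adj u v → c u = c v → c u = j₀) ∧
    (G.induce {v | c v = j₀}).CliqueFree 3

/-- Membership in the family `H_1(n,e)`: `(n,e)`-graphs obtained from a complete
`(k-1)`-partite graph by adding a triangle-free graph into one part. -/
def MemH1 (n e : ℕ) (G : SimpleGraph (Fin n)) : Prop :=
  edgeCnt G = e ∧
  ∃ (c : Fin n → Fin (kk n e - 1)) (j₀ : Fin (kk n e - 1)),
    (∀ u v, c u ≠ c v → G.Adj u v) ∧
    (∀ u v, G.Adj u v → c u = c v → c u = j₀) ∧
    (G.induce {v | c v = j₀}).CliqueFree 3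

/-- Membership in the family `H_0(n,e)`: `(n,e)`-graphs obtained from a complete
`(k-1)`-partite graph by adding a (possibly empty) triangle-free graph into each part. -/
def MemH0 (n e : ℕ) (G : SimpleGraph (Fin n)) : Prop :=
  edgeCnt G = e ∧
  ∃ c : Fin n → Fin (kk n e - 1),
    (∀ u v, c u ≠ c v → G.Adj u v) ∧
    ∀ j, (G.induce {v | c v = j}).CliqueFree 3

/-- Membership (up to isomorphism) in the family `H_1*(n,e)`: graphs obtained from the
complete `k`-partite graph with part sizes `a_1*, …, a_k*` by replacing, for some
`i ∈ [k-1]` (with `i = k-1` if `m* > 0`), the complete bipartite graph between parts `i`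
and `k` by an arbitrary triangle-free graph on the union of these two parts with
`a_i* a_k* - m*` edges. -/
def MemH1star (n e : ℕ) (G : SimpleGraph (Fin n)) : Prop :=
  edgeCnt G = e ∧
  ∃ (c : Fin n → ℕ) (i : ℕ),
    (∀ v, c v ∈ Finset.Icc 1 (kk n e)) ∧
    (∀ j ∈ Finset.Icc 1 (kk n e), {v | c v = j}.ncard = aStar n e j) ∧
    i ∈ Finset.Icc 1 (kk n e - 1) ∧
    (0 < mStar n e → i = kk n e - 1) ∧
    (∀ u v, c u ≠ c v →
      (c u ∉ ({i, kk n e} : Set ℕ) ∨ c v ∉ ({i, kk n e} : Set ℕ)) → G.Adj u v) ∧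
    (∀ u v, G.Adj u v → c u = c v → c u = i ∨ c u = kk n e) ∧
    (G.induce {v | c v = i ∨ c v = kk n e}).CliqueFree 3

/-- Membership (up to isomorphism) in the family `H_2*(n,e)`. -/
def MemH2star (n e : ℕ) (G : SimpleGraph (Fin n)) : Prop :=
  (MemH1star n e G ∧ G.Colorable (kk n e)) ∨
  (edgeCnt G = e ∧
   ∃ (c : Fin n → ℕ) (sz : ℕ → ℕ) (f : Fin n → ℕ),
     ((∀ j, sz j = aStar n e j) ∨
      (mStar n e = 0 ∧ aStar n e (kk n e) + 2 ≤ aStar n e 1 ∧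
       (∀ j ∈ Finset.Icc 1 (kk n e - 2), sz j = aStar n e (j + 1)) ∧
       sz (kk n e - 1) = aStar n e 1 - 1 ∧ sz (kk n e) = aStar n e (kk n e) + 1)) ∧
     (∀ v, c v ∈ Finset.Icc 1 (kk n e)) ∧
     (∀ j ∈ Finset.Icc 1 (kk n e), {v | c v = j}.ncard = sz j) ∧
     (∀ u v, G.Adj u v → c u ≠ c v) ∧
     (∀ u v, c u ≠ c v → ¬ G.Adj u v → c v = kk n e →
        c u ∈ Finset.Icc 1 (kk n e - 1) ∧ sz (c u) = sz (kk n e - 1) ∧ c u = f v) ∧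
     (∀ u v, c u ≠ c v → ¬ G.Adj u v → c u = kk n e ∨ c v = kk n e))

/-- Partial sums of the part sizes `a_i*`. -/
noncomputable def csum (n e j : ℕ) : ℕ := ∑ i ∈ Finset.Icc 1 j, aStar n e i

/-- The part (in `[k]`) of the vertex with index `v` in the canonical construction. -/
noncomputable def partOf (n e v : ℕ) : ℕ := sInf {j : ℕ | v < csum n e j}

/-- The graph `H*(n,e)`: the complete `k`-partite graph with part sizes `a_1*, …, a_k*`
minus an `m*`-edge star whose centre lies in part `k` and whose leaves lie in part `k-1`. -/
noncomputable def HstarG (n e : ℕ) : SimpleGraph (Fin n) :=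
  SimpleGraph.fromRel (fun u v =>
    partOf n e u ≠ partOf n e v ∧
    ¬ (((u : ℕ) = csum n e (kk n e - 1) ∧
          csum n e (kk n e - 2) ≤ (v : ℕ) ∧
          (v : ℕ) < csum n e (kk n e - 2) + mStar n e) ∨
       ((v : ℕ) = csum n e (kk n e - 1) ∧
          csum n e (kk n e - 2) ≤ (u : ℕ) ∧
          (u : ℕ) < csum n e (kk n e - 2) + mStar n e)))

/-- `g_r(n,e)`: the minimum number of `r`-cliques among all graphs with `n` vertices and
`e` edges. -/
noncomputable def gMin (n e r : ℕ) : ℕ :=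
  sInf {N : ℕ | ∃ G : SimpleGraph (Fin n), edgeCnt G = e ∧ NK G r = N}

/-- The elementary symmetric sum of degree `r` of the values of `f` on `S`. -/
def esymmOn {ι R : Type*} [CommSemiring R] (S : Finset ι) (f : ι → R) (r : ℕ) : R :=
  ∑ I ∈ S.powersetCard r, ∏ i ∈ I, f i

section esymmOn

variable {ι R : Type*} [CommSemiring R]

theorem esymmOn_zero (S : Finset ι) (f : ι → R) : esymmOn S f 0 = 1 := by
  simp [esymmOn]

theorem esymmOn_one (S : Finset ι) (f : ι → R) : esymmOn S f 1 = ∑ i ∈ S, f i := by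
  simp [esymmOn, Finset.powersetCard_one]

theorem esymmOn_empty_succ (f : ι → R) (r : ℕ) : esymmOn ∅ f (r + 1) = 0 := by
  rw [esymmOn, Finset.powersetCard_eq_empty.2 (by simp), Finset.sum_empty]

theorem esymmOn_congr {S : Finset ι} {f g : ι → R} (h : ∀ i ∈ S, f i = g i) (r : ℕ) :
    esymmOn S f r = esymmOn S g r := by
  refine Finset.sum_congr rfl fun I hI => Finset.prod_congr rfl fun i hi => h i ?_
  exact (Finset.mem_powersetCard.1 hI).1 hi

theorem natCast_esymmOn (S : Finset ι) (f : ι → ℕ) (r : ℕ) :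
    ((esymmOn S f r : ℕ) : R) = esymmOn S (fun i => (f i : R)) r := by
  simp [esymmOn]

theorem esymmOn_map {κ : Type*} [DecidableEq ι] (S : Finset κ) (φ : κ ↪ ι) (f : ι → R)
    (r : ℕ) : esymmOn (S.map φ) f r = esymmOn S (fun j => f (φ j)) r := by
  simp [esymmOn, Finset.powersetCard_map]

variable [DecidableEq ι]

theorem esymmOn_insert_succ {S : Finset ι} {x : ι} (hx : x ∉ S) (f : ι → R) (r : ℕ) :
    esymmOn (insert x S) f (r + 1) = esymmOn S f (r + 1) + f x * esymmOn S f r := by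
  have hmem : ∀ I ∈ S.powersetCard r, x ∉ I := fun I hI hxI =>
    hx ((Finset.mem_powersetCard.1 hI).1 hxI)
  rw [esymmOn, Finset.powersetCard_succ_insert hx, Finset.sum_union, Finset.sum_image, esymmOn,
    esymmOn, Finset.mul_sum]
  · congr 1
    exact Finset.sum_congr rfl fun I hI => Finset.prod_insert (hmem I hI)
  · intro I hI J hJ h
    rw [← Finset.erase_insert (hmem I hI), h, Finset.erase_insert (hmem J hJ)]
  · rw [Finset.disjoint_left]
    intro I hI hI'
    obtain ⟨J, -, rfl⟩ := Finset.mem_image.1 hI'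
    exact hx ((Finset.mem_powersetCard.1 hI).1 (Finset.mem_insert_self x J))

theorem esymmOn_insert_insert {S : Finset ι} {x y : ι} (hx : x ∉ S) (hy : y ∉ S) (hxy : x ≠ y)
    (f : ι → R) (r : ℕ) :
    esymmOn (insert x (insert y S)) f (r + 2) =
      esymmOn S f (r + 2) + (f x + f y) * esymmOn S f (r + 1) + f x * f y * esymmOn S f r := by
  rw [esymmOn_insert_succ (by simp [hx, hxy]), esymmOn_insert_succ hy, esymmOn_insert_succ hy]
  ring

theorem esymmOn_erase_eq {S : Finset ι} {x y : ι} (hx : x ∈ S) (hy : y ∈ S) {f : ι → R}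
    (h : f x = f y) (r : ℕ) : esymmOn (S.erase x) f r = esymmOn (S.erase y) f r := by
  rcases eq_or_ne x y with rfl | hxy
  · rfl
  obtain - | r := r
  · simp only [esymmOn_zero]
  have h1 : S.erase x = insert y ((S.erase x).erase y) :=
    (Finset.insert_erase (by simp [hy, hxy.symm])).symm
  have h2 : S.erase y = insert x ((S.erase x).erase y) := by
    rw [Finset.erase_right_comm, Finset.insert_erase (by simp [hx, hxy])]
  rw [h1, esymmOn_insert_succ (by simp), h2, esymmOn_insert_succ (by simp), ← h]

theorem two_mul_esymmOn_two_add_sum_sq (S : Finset ι) (f : ι → R) :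
    2 * esymmOn S f 2 + ∑ i ∈ S, f i ^ 2 = (∑ i ∈ S, f i) ^ 2 := by
  induction S using Finset.induction_on with
  | empty => simp [esymmOn_empty_succ]
  | insert x S hx ih =>
    rw [esymmOn_insert_succ hx, esymmOn_one, Finset.sum_insert hx, Finset.sum_insert hx, add_sq,
      ← ih]
    ring

end esymmOn

section Turan

theorem tur_eq_card (s n : ℕ) : tur s n = (SimpleGraph.turanGraph n s).edgeFinset.card := by
  rw [tur, edgeCnt, ← SimpleGraph.coe_edgeFinset, Set.ncard_coe_finset]

theorem tur_of_le {s n : ℕ} (h : n ≤ s) : tur s n = n.choose 2 := by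
  have h1 := SimpleGraph.card_edgeFinset_top_eq_card_choose_two (V := Fin n)
  rw [Fintype.card_fin] at h1
  rw [tur_eq_card, ← h1]
  congr! 2
  exact SimpleGraph.turanGraph_eq_top.2 (Or.inr h)

theorem tur_mono {s t : ℕ} (hs : 0 < s) (hst : s ≤ t) (n : ℕ) : tur s n ≤ tur t n := by
  rw [tur_eq_card, tur_eq_card]
  convert! (SimpleGraph.isTuranMaximal_turanGraph (n := n) (hs.trans_le hst)).2
    ((SimpleGraph.turanGraph_cliqueFree (n := n) hs).mono (by omega))

theorem two_mul_tur_add {s p : ℕ} (hs : 0 < s) (hp : p ≤ s) (q : ℕ) :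
    2 * tur s (s * q + p) + (s * q ^ 2 + p * (2 * q + 1)) = (s * q + p) ^ 2 := by
  have hchoose : ∀ m : ℕ, 2 * m.choose 2 + m = m ^ 2 := fun m => by
    rw [Nat.choose_two_right, Nat.mul_div_cancel' (Nat.even_mul_pred_self m).two_dvd]
    obtain - | m := m
    · rfl
    · simp only [Nat.add_sub_cancel]; ring
  induction q with
  | zero => simpa [tur_of_le hp] using hchoose p
  | succ q ih =>
    have h1 := SimpleGraph.card_edgeFinset_turanGraph_add (n := s * q + p) (r := s)
    rw [← tur_eq_card, ← tur_eq_card] at h1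
    have h2 : s * (q + 1) + p = s * q + p + s := by ring
    obtain ⟨s, rfl⟩ : ∃ t, s = t + 1 := ⟨s - 1, by omega⟩
    have h3 := hchoose (s + 1)
    rw [h2, h1]
    simp only [Nat.add_sub_cancel]
    nlinarith

theorem sum_balanced {R : Type*} [CommSemiring R] {s p : ℕ} (hp : p ≤ s) (a b : R) :
    ∑ i ∈ Finset.Icc 1 s, (if i ≤ p then a else b) = p * a + (s - p : ℕ) * b := by
  rw [Finset.sum_ite, Finset.sum_const, Finset.sum_const, nsmul_eq_mul, nsmul_eq_mul]
  have h1 : (Finset.Icc 1 s).filter (· ≤ p) = Finset.Icc 1 p := by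
    ext i; simp only [Finset.mem_filter, Finset.mem_Icc]; omega
  have h2 : (Finset.Icc 1 s).filter (¬ · ≤ p) = Finset.Icc (p + 1) s := by
    ext i; simp only [Finset.mem_filter, Finset.mem_Icc]; omega
  rw [h1, h2, Nat.card_Icc, Nat.card_Icc]
  simp

theorem sum_balanced_eq {s : ℕ} (hs : 0 < s) (n : ℕ) :
    ∑ i ∈ Finset.Icc 1 s, (n / s + if i ≤ n % s then 1 else 0) = n := by
  rw [Finset.sum_add_distrib, sum_balanced (Nat.mod_lt n hs).le]
  simp [Nat.div_add_mod]

theorem esymmOn_two_balanced {s : ℕ} (hs : 0 < s) (n : ℕ) :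
    esymmOn (Finset.Icc 1 s) (fun i => n / s + if i ≤ n % s then 1 else 0) 2 = tur s n := by
  have hp := (Nat.mod_lt n hs).le
  have h1 := two_mul_esymmOn_two_add_sum_sq (Finset.Icc 1 s)
    (fun i => n / s + if i ≤ n % s then 1 else 0)
  have h2 := two_mul_tur_add hs hp (n / s)
  have h3 : ∑ i ∈ Finset.Icc 1 s, (n / s + if i ≤ n % s then 1 else 0) ^ 2 =
      s * (n / s) ^ 2 + n % s * (2 * (n / s) + 1) := by
    have h4 : ∀ i, (n / s + if i ≤ n % s then 1 else 0) ^ 2 =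
        (n / s) ^ 2 + if i ≤ n % s then 2 * (n / s) + 1 else 0 := fun i => by
      split_ifs <;> ring
    simp only [h4, Finset.sum_add_distrib, sum_balanced hp]
    simp
  rw [sum_balanced_eq hs, h3] at h1
  rw [Nat.div_add_mod] at h2
  omega

/-- Splitting off a smallest part of the Turán graph leaves a Turán graph. -/
theorem tur_succ_eq {s : ℕ} (hs : 0 < s) (n : ℕ) :
    tur (s + 1) n = n / (s + 1) * (n - n / (s + 1)) + tur s (n - n / (s + 1)) := by
  set q := n / (s + 1)
  set p := n % (s + 1)
  have hp : p ≤ s := Nat.lt_succ_iff.1 (Nat.mod_lt n s.succ_pos)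
  have hn : (s + 1) * q + p = n := Nat.div_add_mod n (s + 1)
  have h1 := two_mul_tur_add s.succ_pos (hp.trans s.le_succ) q
  have h2 := two_mul_tur_add hs hp q
  have h3 : n - q = s * q + p := by rw [← hn, add_one_mul]; omega
  rw [hn, ← hn] at h1
  rw [h3]
  rw [hn] at h1
  nlinarith

end Turan

section Parameters

variable {n e r : ℕ}

theorem le_tur_kk (he : e ≤ n.choose 2) : 1 ≤ kk n e ∧ e ≤ tur (kk n e) n :=
  Nat.sInf_mem (s := {s : ℕ | 1 ≤ s ∧ e ≤ tur s n})
    ⟨n + 1, by omega, by rw [tur_of_le (by omega)]; exact he⟩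

theorem kk_le (hn : 0 < n) (he : e ≤ n.choose 2) : kk n e ≤ n :=
  Nat.sInf_le ⟨hn, by rw [tur_of_le le_rfl]; exact he⟩

theorem lt_kk (he1 : tur r n < e) (he2 : e ≤ n.choose 2) : r < kk n e := by
  by_contra! h
  have := le_tur_kk he2
  have := tur_mono this.1 h n
  omega

theorem le_aLast (hn : 0 < n) (hk : 2 ≤ kk n e) (he : e ≤ n.choose 2) :
    aLast n e ≤ n ∧ e ≤ aLast n e * (n - aLast n e) + tur (kk n e - 1) (n - aLast n e) := by
  have hmem : n / kk n e ∈
      {a : ℕ | 1 ≤ a ∧ e ≤ a * (n - a) + tur (kk n e - 1) (n - a)} := by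
    refine ⟨(Nat.one_le_div_iff (by omega)).2 (kk_le hn he), ?_⟩
    obtain ⟨s, hs⟩ : ∃ s, kk n e = s + 1 := ⟨kk n e - 1, by omega⟩
    have h1 := (le_tur_kk he).2
    rw [hs, tur_succ_eq (by omega)] at h1
    rw [hs]
    exact h1
  exact ⟨(Nat.sInf_le hmem).trans (Nat.div_le_self _ _), (Nat.sInf_mem ⟨_, hmem⟩).2⟩

theorem le_esymmOn_aStar (hn : 0 < n) (hk : 2 ≤ kk n e) (he : e ≤ n.choose 2) :
    e ≤ esymmOn (Finset.Icc 1 (kk n e)) (aStar n e) 2 := by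
  have hS : Finset.Icc 1 (kk n e) = insert (kk n e) (Finset.Icc 1 (kk n e - 1)) := by
    ext i; simp only [Finset.mem_insert, Finset.mem_Icc]; omega
  have hk' : kk n e ∉ Finset.Icc 1 (kk n e - 1) := by
    simp only [Finset.mem_Icc]; omega
  have hc : ∀ i ∈ Finset.Icc 1 (kk n e - 1), aStar n e i = (n - aLast n e) / (kk n e - 1) +
      if i ≤ (n - aLast n e) % (kk n e - 1) then 1 else 0 := fun i hi => by
    rw [aStar, if_neg]
    rintro rfl
    exact hk' hi
  rw [hS, esymmOn_insert_succ hk', esymmOn_one, esymmOn_congr hc, Finset.sum_congr rfl hc,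
    esymmOn_two_balanced (by omega), sum_balanced_eq (by omega), aStar, if_pos rfl, add_comm]
  exact (le_aLast hn hk he).2

/-- The defining difference of `mStar` is not truncated. -/
theorem add_mStar (hn : 0 < n) (hk : 2 ≤ kk n e) (he : e ≤ n.choose 2) :
    e + mStar n e = esymmOn (Finset.Icc 1 (kk n e)) (aStar n e) 2 :=
  Nat.add_sub_cancel' (le_esymmOn_aStar hn hk he)

end Parameters

open scoped Classical in
/-- The number of `r`-cliques of `G` contained in the vertex set `U`. -/
noncomputable def cliqueCount {V : Type*} (G : SimpleGraph V) (U : Finset V) (r : ℕ) : ℕ :=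
  ((U.powersetCard r).filter fun s : Finset V => G.IsClique (s : Set V)).card

section cliqueCount

variable {V : Type*} (G : SimpleGraph V)

theorem cliqueCount_eq_card_filter [DecidablePred fun s : Finset V => G.IsClique (s : Set V)]
    (U : Finset V) (r : ℕ) : cliqueCount G U r =
      ((U.powersetCard r).filter fun s : Finset V => G.IsClique (s : Set V)).card := by
  unfold cliqueCount
  congr!

theorem NK_eq_cliqueCount [Fintype V] (r : ℕ) : NK G r = cliqueCount G Finset.univ r := by
  classical
  rw [NK, cliqueCount, ← Set.ncard_coe_finset]
  refine congrArg Set.ncard (Set.ext fun s => ?_)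
  simp [SimpleGraph.isNClique_iff, Finset.mem_powersetCard, and_comm]

theorem NK_two : NK G 2 = edgeCnt G := by
  classical
  have h : {s : Finset V | G.IsNClique 2 s} = Sym2.toFinset '' G.edgeSet := by
    ext s
    simp only [Set.mem_ofPred_eq, Set.mem_image, SimpleGraph.isNClique_iff, Finset.card_eq_two]
    constructor
    · rintro ⟨hs, a, b, hab, rfl⟩
      exact ⟨s(a, b), hs (by simp) (by simp) hab, by ext; simp⟩
    · rintro ⟨z, hz, rfl⟩
      induction z with
      | h a b =>
        rw [SimpleGraph.mem_edgeSet] at hz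
        refine ⟨?_, a, b, hz.ne, by ext; simp⟩
        have : (s(a, b).toFinset : Set V) = {a, b} := by ext; simp
        rw [this, SimpleGraph.isClique_pair]
        exact fun _ => hz
  rw [NK, edgeCnt, h, Set.ncard_image_of_injective]
  intro a b hab
  ext x
  rw [← Sym2.mem_toFinset, hab, Sym2.mem_toFinset]

theorem cliqueCount_zero (U : Finset V) : cliqueCount G U 0 = 1 := by
  simp [cliqueCount, Finset.filter_singleton]

theorem cliqueCount_one (U : Finset V) : cliqueCount G U 1 = U.card := by
  classical
  rw [cliqueCount, Finset.filter_true_of_mem, Finset.card_powersetCard, Nat.choose_one_right]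
  intro s hs
  obtain ⟨a, rfl⟩ := Finset.card_eq_one.1 (Finset.mem_powersetCard.1 hs).2
  simp

theorem cliqueCount_empty_succ (r : ℕ) : cliqueCount G ∅ (r + 1) = 0 := by
  rw [cliqueCount, Finset.powersetCard_eq_empty.2 (by simp)]
  simp

theorem cliqueCount_eq_zero {U : Finset V} {r j : ℕ}
    (h : (G.induce (U : Set V)).CliqueFree r) (hj : r ≤ j) : cliqueCount G U j = 0 := by
  classical
  rw [cliqueCount, Finset.card_eq_zero, Finset.filter_eq_empty_iff]
  intro s hs hclique
  rw [Finset.mem_powersetCard] at hs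
  refine h.mono hj (s.subtype (· ∈ (U : Set V))) ?_
  rw [SimpleGraph.isNClique_induce_iff, SimpleGraph.isNClique_iff]
  have hmap : (s.subtype (· ∈ (U : Set V))).map (Function.Embedding.subtype _) = s := by
    rw [Finset.subtype_map]
    exact Finset.filter_true_of_mem fun x hx => hs.1 hx
  rw [hmap]
  exact ⟨hclique, hs.2⟩

variable [DecidableEq V]

open scoped Classical in
theorem cliqueCount_insert {U : Finset V} {v : V} (hv : v ∉ U) (r : ℕ) :
    cliqueCount G (insert v U) (r + 1) =
      cliqueCount G U (r + 1) + cliqueCount G (U.filter (G.Adj v)) r := by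
  have hmem : ∀ s ∈ U.powersetCard r, v ∉ s := fun s hs hvs =>
    hv ((Finset.mem_powersetCard.1 hs).1 hvs)
  rw [cliqueCount_eq_card_filter, Finset.powersetCard_succ_insert hv, Finset.filter_union,
    Finset.card_union_of_disjoint, Finset.filter_image, Finset.card_image_of_injOn,
    cliqueCount_eq_card_filter, cliqueCount_eq_card_filter]
  · congr 2
    ext s
    simp only [Finset.mem_filter, Finset.mem_powersetCard, Finset.coe_insert,
      SimpleGraph.isClique_insert, Finset.subset_iff, Finset.mem_filter, Finset.mem_coe]
    constructor
    · rintro ⟨⟨hs, hr⟩, hc, hadj⟩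
      exact ⟨⟨fun x hx => ⟨hs hx, hadj x hx (by rintro rfl; exact hv (hs hx))⟩, hr⟩, hc⟩
    · rintro ⟨⟨hs, hr⟩, hc⟩
      exact ⟨⟨fun x hx => (hs hx).1, hr⟩, hc, fun x hx _ => (hs hx).2⟩
  · intro s hs t ht h
    have hs' := hmem s (Finset.mem_filter.1 hs).1
    have ht' := hmem t (Finset.mem_filter.1 ht).1
    rw [← Finset.erase_insert hs', ← Finset.erase_insert ht']
    exact congrArg (Finset.erase · v) h
  · rw [Finset.disjoint_left]
    intro s hs hs'
    obtain ⟨t, -, rfl⟩ := Finset.mem_image.1 (Finset.mem_filter.1 hs').1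
    exact hv ((Finset.mem_powersetCard.1 (Finset.mem_filter.1 hs).1).1
      (Finset.mem_insert_self v t))

open scoped Classical in
/-- Splitting off an independent set. -/
theorem cliqueCount_union_of_indep {A U : Finset V} (hAU : Disjoint A U)
    (hA : ∀ u ∈ A, ∀ v ∈ A, ¬ G.Adj u v) (r : ℕ) :
    cliqueCount G (A ∪ U) (r + 1) =
      cliqueCount G U (r + 1) + ∑ v ∈ A, cliqueCount G (U.filter (G.Adj v)) r := by
  induction A using Finset.induction_on with
  | empty => simp
  | insert v A hv ih =>
    rw [Finset.disjoint_insert_left] at hAU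
    rw [Finset.insert_union, cliqueCount_insert G (by simp [hv, hAU.1]),
      ih hAU.2 fun u hu w hw => hA u (by simp [hu]) w (by simp [hw]), Finset.sum_insert hv,
      Finset.filter_union, Finset.filter_false_of_mem
        fun u hu => hA v (by simp) u (by simp [hu]), Finset.empty_union]
    ring

/-- Cliques in the join of the graph on `W` with a complete multipartite graph. -/
theorem cliqueCount_join {ι : Type*} [DecidableEq ι] (S : Finset ι) (P : ι → Finset V)
    (W : Finset V) (hP : ∀ i ∈ S, ∀ u ∈ P i, ∀ v ∈ P i, ¬ G.Adj u v)
    (hadj : ∀ i ∈ S, ∀ j ∈ S, i ≠ j → ∀ u ∈ P i, ∀ v ∈ P j, G.Adj u v)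
    (hW : ∀ i ∈ S, ∀ u ∈ P i, ∀ w ∈ W, G.Adj u w) (r : ℕ) :
    cliqueCount G (S.biUnion P ∪ W) r =
      ∑ p ∈ Finset.HasAntidiagonal.antidiagonal r,
        esymmOn S (fun i => (P i).card) p.1 * cliqueCount G W p.2 := by
  classical
  induction S using Finset.induction_on generalizing r with
  | empty =>
    obtain - | r := r
    · simp [cliqueCount_zero, esymmOn_zero]
    · simp [Finset.Nat.sum_antidiagonal_succ, esymmOn_zero, esymmOn_empty_succ]
  | insert x S hx ih =>
    obtain - | r := r
    · simp [cliqueCount_zero, esymmOn_zero]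
    have ih' := ih (fun i hi => hP i (by simp [hi]))
      (fun i hi j hj => hadj i (by simp [hi]) j (by simp [hj])) (fun i hi => hW i (by simp [hi]))
    have hx' : ∀ u ∈ P x, ∀ v ∈ S.biUnion P ∪ W, G.Adj u v := by
      intro u hu v hv
      rcases Finset.mem_union.1 hv with hv | hv
      · obtain ⟨j, hj, hv⟩ := Finset.mem_biUnion.1 hv
        exact hadj x (by simp) j (by simp [hj]) (by rintro rfl; exact hx hj) u hu v hv
      · exact hW x (by simp) u hu v hv
    rw [Finset.biUnion_insert, Finset.union_assoc, cliqueCount_union_of_indep G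
      (Finset.disjoint_left.2 fun u hu hu' => G.loopless.irrefl u (hx' u hu u hu')) (hP x (by simp)),
      Finset.sum_congr rfl fun v hv => by rw [Finset.filter_true_of_mem (hx' v hv)],
      ih', ih', Finset.Nat.sum_antidiagonal_succ, Finset.Nat.sum_antidiagonal_succ]
    simp only [esymmOn_insert_succ hx, esymmOn_zero, add_mul, Finset.sum_add_distrib,
      Finset.sum_const, smul_eq_mul, Finset.mul_sum, mul_assoc, add_assoc]

theorem cliqueCount_multipartite {ι : Type*} [DecidableEq ι] (S : Finset ι) (P : ι → Finset V)
    (hP : ∀ i ∈ S, ∀ u ∈ P i, ∀ v ∈ P i, ¬ G.Adj u v)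
    (hadj : ∀ i ∈ S, ∀ j ∈ S, i ≠ j → ∀ u ∈ P i, ∀ v ∈ P j, G.Adj u v) (r : ℕ) :
    cliqueCount G (S.biUnion P) r = esymmOn S (fun i => (P i).card) r := by
  have h := cliqueCount_join G S P ∅ hP hadj (by simp) r
  rw [Finset.union_empty] at h
  rw [h]
  obtain - | r := r
  · simp [cliqueCount_zero]
  · simp [Finset.Nat.sum_antidiagonal_succ', cliqueCount_zero, cliqueCount_empty_succ]

/-- Cliques in the join of a complete multipartite graph with a triangle-free graph. -/
theorem cliqueCount_join_triangleFree {ι : Type*} [DecidableEq ι] (S : Finset ι)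
    (P : ι → Finset V) (W : Finset V) (hP : ∀ i ∈ S, ∀ u ∈ P i, ∀ v ∈ P i, ¬ G.Adj u v)
    (hadj : ∀ i ∈ S, ∀ j ∈ S, i ≠ j → ∀ u ∈ P i, ∀ v ∈ P j, G.Adj u v)
    (hW : ∀ i ∈ S, ∀ u ∈ P i, ∀ w ∈ W, G.Adj u w)
    (hfree : (G.induce (W : Set V)).CliqueFree 3) (r : ℕ) :
    cliqueCount G (S.biUnion P ∪ W) (r + 2) =
      esymmOn S (fun i => (P i).card) (r + 2) +
        W.card * esymmOn S (fun i => (P i).card) (r + 1) +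
        cliqueCount G W 2 * esymmOn S (fun i => (P i).card) r := by
  have h3 : ∀ j, cliqueCount G W (j + 1 + 1 + 1) = 0 := fun j =>
    cliqueCount_eq_zero G hfree (by omega)
  rw [cliqueCount_join G S P W hP hadj hW, Finset.Nat.sum_antidiagonal_succ',
    Finset.Nat.sum_antidiagonal_succ']
  obtain - | r := r
  · simp [cliqueCount_zero, cliqueCount_one]
    ring
  · rw [Finset.Nat.sum_antidiagonal_succ']
    simp [cliqueCount_zero, cliqueCount_one, h3]
    ring

end cliqueCount

section Families

variable {n : ℕ} {G : SimpleGraph (Fin n)}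

theorem card_filter_eq_ncard {c : Fin n → ℕ} (j : ℕ) :
    (Finset.univ.filter (c · = j)).card = {v | c v = j}.ncard := by
  rw [← Set.ncard_coe_finset]
  simp

theorem Icc_pred_erase {k : ℕ} :
    (Finset.Icc 1 (k - 1)).erase (k - 1) = Finset.Icc 1 (k - 2) := by
  ext i; simp only [Finset.mem_erase, Finset.mem_Icc]; omega

theorem insert_Icc_pred {k : ℕ} (hk : 1 ≤ k) :
    insert k (Finset.Icc 1 (k - 1)) = Finset.Icc 1 k := by
  ext i; simp only [Finset.mem_insert, Finset.mem_Icc]; omega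

theorem NK_of_MemH1star {e : ℕ} (hn : 0 < n) (hk : 2 ≤ kk n e) (he : e ≤ n.choose 2)
    (hG : MemH1star n e G) (r : ℕ) :
    (NK G (r + 2) : ℤ) = esymmOn (Finset.Icc 1 (kk n e)) (fun i => (aStar n e i : ℤ)) (r + 2) -
      mStar n e * esymmOn (Finset.Icc 1 (kk n e - 2)) (fun i => (aStar n e i : ℤ)) r := by
  obtain ⟨hcard, c, i, hc, hsz, hi, him, hadj, hpart, hfree⟩ := hG
  have hm := add_mStar hn hk he
  generalize hkk : kk n e = k at *
  rw [Finset.mem_Icc] at hi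
  set P : ℕ → Finset (Fin n) := fun j => Finset.univ.filter (c · = j) with hPdef
  set S := ((Finset.Icc 1 k).erase k).erase i with hS
  set W : Finset (Fin n) := Finset.univ.filter fun v => c v = i ∨ c v = k with hW
  have hmemS : ∀ j, j ∈ S ↔ j ≠ i ∧ j ≠ k ∧ 1 ≤ j ∧ j ≤ k := fun j => by
    simp only [hS, Finset.mem_erase, Finset.mem_Icc]
  have hSk : insert i (insert k S) = Finset.Icc 1 k := by
    ext j; simp only [Finset.mem_insert, hmemS, Finset.mem_Icc]; omega
  have hP : ∀ j ∈ Finset.Icc 1 k, (P j).card = aStar n e j := fun j hj => by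
    rw [← hsz j hj, ← card_filter_eq_ncard]
  have hPS : ∀ j ∈ S, (P j).card = aStar n e j := fun j hj =>
    hP j (hSk ▸ by simp [hj])
  have hWcard : W.card = aStar n e i + aStar n e k := by
    rw [← hP i (Finset.mem_Icc.2 ⟨hi.1, by omega⟩), ← hP k (Finset.mem_Icc.2 ⟨by omega, le_rfl⟩),
      hW, Finset.filter_or, Finset.card_union_of_disjoint]
    rw [Finset.disjoint_filter]
    intro v _ hv hv'
    omega
  have huniv : Finset.univ = S.biUnion P ∪ W := by
    ext v
    have := Finset.mem_Icc.1 (hc v)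
    simp only [Finset.mem_univ, Finset.mem_union, Finset.mem_biUnion, hPdef, hW,
      Finset.mem_filter, true_and, true_iff, exists_eq_right', hmemS]
    omega
  have hfree' : (G.induce (W : Set (Fin n))).CliqueFree 3 := by
    have hWset : (W : Set (Fin n)) = {v | c v = i ∨ c v = k} := by ext; simp [hW]
    rw [hWset]
    exact hfree
  have key : ∀ s, NK G (s + 2) = esymmOn S (aStar n e) (s + 2) +
      (aStar n e i + aStar n e k) * esymmOn S (aStar n e) (s + 1) +
      cliqueCount G W 2 * esymmOn S (aStar n e) s := fun s => by
    rw [NK_eq_cliqueCount, huniv, cliqueCount_join_triangleFree G S P W, hWcard,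
      esymmOn_congr hPS, esymmOn_congr hPS, esymmOn_congr hPS]
    · intro j hj u hu v hv huv
      simp only [hPdef, Finset.mem_filter, Finset.mem_univ, true_and] at hu hv
      have := hpart u v huv (hu.trans hv.symm)
      rw [hmemS] at hj
      omega
    · intro j hj j' hj' hne u hu v hv
      simp only [hPdef, Finset.mem_filter, Finset.mem_univ, true_and] at hu hv
      rw [hmemS] at hj
      exact hadj u v (by omega) (Or.inl (by simp [hu, hj.1, hj.2.1]))
    · intro j hj u hu v hv
      simp only [hPdef, hW, Finset.mem_filter, Finset.mem_univ, true_and] at hu hv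
      rw [hmemS] at hj
      exact hadj u v (by omega) (Or.inl (by simp [hu, hj.1, hj.2.1]))
    · exact hfree'
  have hiS : i ∉ S := by simp [hmemS]
  have hkS : k ∉ S := by simp [hmemS]
  have h2 := key 0
  rw [Nat.zero_add, NK_two, hcard] at h2
  rw [← hSk, esymmOn_insert_insert hiS hkS (by omega)] at hm
  rw [Nat.zero_add] at h2
  simp only [esymmOn_zero, Nat.zero_add, mul_one] at h2 hm
  have hE : (cliqueCount G W 2 : ℤ) = aStar n e i * aStar n e k - mStar n e := by
    zify at h2 hm
    linarith
  have h3 : (mStar n e : ℤ) * esymmOn (Finset.Icc 1 (k - 2)) (fun i => (aStar n e i : ℤ)) r =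
      mStar n e * esymmOn S (fun i => (aStar n e i : ℤ)) r := by
    rcases Nat.eq_zero_or_pos (mStar n e) with h0 | h0
    · simp [h0]
    · have : Finset.Icc 1 (k - 2) = S := by
        have := him h0
        ext j; simp only [hmemS, Finset.mem_Icc]; omega
      rw [this]
  rw [h3, key, ← hSk, esymmOn_insert_insert hiS hkS (by omega)]
  push_cast [natCast_esymmOn]
  rw [hE]
  ring

open scoped Classical in
/-- Cliques in the common neighbourhood of a vertex `v` with a complete multipartite graph, when
all non-neighbours of `v` lie in a single part having the size of the last one. -/
theorem cliqueCount_neighbors {V : Type*} [DecidableEq V] {G : SimpleGraph V} {k : ℕ}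
    (hk : 2 ≤ k) {P : ℕ → Finset V}
    (hP : ∀ i ∈ Finset.Icc 1 (k - 1), ∀ u ∈ P i, ∀ v ∈ P i, ¬ G.Adj u v)
    (hadj : ∀ i ∈ Finset.Icc 1 (k - 1), ∀ j ∈ Finset.Icc 1 (k - 1), i ≠ j →
      ∀ u ∈ P i, ∀ v ∈ P j, G.Adj u v)
    {v : V} {j : ℕ} (hj : ∀ i ∈ Finset.Icc 1 (k - 1), ∀ u ∈ P i, ¬ G.Adj v u →
      i = j ∧ (P i).card = (P (k - 1)).card) (r : ℕ) :
    (cliqueCount G (((Finset.Icc 1 (k - 1)).biUnion P).filter (G.Adj v)) (r + 1) : ℤ) =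
      esymmOn (Finset.Icc 1 (k - 1)) (fun i => ((P i).card : ℤ)) (r + 1) -
        (((Finset.Icc 1 (k - 1)).biUnion P).filter (¬ G.Adj v ·)).card *
          esymmOn (Finset.Icc 1 (k - 2)) (fun i => ((P i).card : ℤ)) r := by
  set S := Finset.Icc 1 (k - 1)
  rw [Finset.filter_biUnion, cliqueCount_multipartite, natCast_esymmOn]
  rotate_left
  · exact fun i hi u hu w hw => hP i hi u (Finset.mem_filter.1 hu).1 w (Finset.mem_filter.1 hw).1
  · exact fun i hi i' hi' hne u hu w hw =>
      hadj i hi i' hi' hne u (Finset.mem_filter.1 hu).1 w (Finset.mem_filter.1 hw).1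
  by_cases h : ∀ i ∈ S, ∀ u ∈ P i, G.Adj v u
  · rw [Finset.filter_false_of_mem, Finset.card_empty, Nat.cast_zero, zero_mul, sub_zero]
    · refine esymmOn_congr (fun i hi => ?_) _
      rw [Finset.filter_true_of_mem (h i hi)]
    · intro u hu
      obtain ⟨i, hi, hu⟩ := Finset.mem_biUnion.1 hu
      exact not_not.2 (h i hi u hu)
  push Not at h
  obtain ⟨i, hi, u, hu, huv⟩ := h
  obtain ⟨rfl, hcard⟩ := hj i hi u hu huv
  have hfull : ∀ i' ∈ S.erase i, (((P i').filter (G.Adj v)).card : ℤ) = (P i').card := by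
    intro i' hi'
    rw [Finset.mem_erase] at hi'
    rw [Finset.filter_true_of_mem]
    intro w hw
    by_contra hvw
    exact hi'.1 (hj i' hi'.2 w hw hvw).1
  have hmissing : (S.biUnion P).filter (¬ G.Adj v ·) = (P i).filter (¬ G.Adj v ·) := by
    ext w
    simp only [Finset.mem_filter, Finset.mem_biUnion]
    constructor
    · rintro ⟨⟨i', hi', hw⟩, hvw⟩
      exact ⟨(hj i' hi' w hw hvw).1 ▸ hw, hvw⟩
    · exact fun hw => ⟨⟨i, hi, hw.1⟩, hw.2⟩
  have herase : esymmOn (Finset.Icc 1 (k - 2)) (fun i => ((P i).card : ℤ)) r =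
      esymmOn (S.erase i) (fun i => ((P i).card : ℤ)) r := by
    rw [← Icc_pred_erase]
    exact esymmOn_erase_eq (Finset.mem_Icc.2 ⟨by omega, le_rfl⟩) hi (by rw [hcard]) r
  have hsum : (((P i).filter (G.Adj v)).card : ℤ) + ((P i).filter (¬ G.Adj v ·)).card =
      (P i).card := by
    exact_mod_cast Finset.card_filter_add_card_filter_not (s := P i) (G.Adj v)
  rw [hmissing, herase, ← Finset.insert_erase hi, esymmOn_insert_succ (Finset.notMem_erase i S),
    esymmOn_insert_succ (Finset.notMem_erase i S), esymmOn_congr hfull, esymmOn_congr hfull,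
    Finset.erase_insert (Finset.notMem_erase i S), ← hsum]
  ring

/-- Cliques of a complete multipartite graph minus edges between the last part and parts as large
as the penultimate one, with the missing edges at each vertex of the last part going to a single
part. -/
theorem NK_of_multipartite_delete {k : ℕ} (hk : 2 ≤ k) {c : Fin n → ℕ} {sz : ℕ → ℕ}
    {f : Fin n → ℕ} (hc : ∀ v, c v ∈ Finset.Icc 1 k)
    (hsz : ∀ j ∈ Finset.Icc 1 k, {v | c v = j}.ncard = sz j)
    (hindep : ∀ u v, G.Adj u v → c u ≠ c v)
    (hf : ∀ u v, c u ≠ c v → ¬ G.Adj u v → c v = k →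
      c u ∈ Finset.Icc 1 (k - 1) ∧ sz (c u) = sz (k - 1) ∧ c u = f v)
    (hlast : ∀ u v, c u ≠ c v → ¬ G.Adj u v → c u = k ∨ c v = k) (r : ℕ) :
    (NK G (r + 2) : ℤ) = esymmOn (Finset.Icc 1 k) (fun i => (sz i : ℤ)) (r + 2) -
      (esymmOn (Finset.Icc 1 k) (fun i => (sz i : ℤ)) 2 - edgeCnt G) *
        esymmOn (Finset.Icc 1 (k - 2)) (fun i => (sz i : ℤ)) r := by
  classical
  set P : ℕ → Finset (Fin n) := fun j => Finset.univ.filter (c · = j) with hPdef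
  have hmem : ∀ v j, v ∈ P j ↔ c v = j := fun v j => by simp [hPdef]
  set U := (Finset.Icc 1 (k - 1)).biUnion P with hU
  have hPcard : ∀ j ∈ Finset.Icc 1 k, ((P j).card : ℤ) = sz j := fun j hj => by
    rw [← hsz j hj, ← card_filter_eq_ncard]
  have hsub : ∀ j ∈ Finset.Icc 1 (k - 1), j ∈ Finset.Icc 1 k := fun j hj => by
    rw [Finset.mem_Icc] at *; omega
  have hsub' : ∀ j ∈ Finset.Icc 1 (k - 2), j ∈ Finset.Icc 1 k := fun j hj => by
    rw [Finset.mem_Icc] at *; omega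
  have hkk : k ∈ Finset.Icc 1 k := Finset.mem_Icc.2 ⟨by omega, le_rfl⟩
  have hk1 : k - 1 ∈ Finset.Icc 1 k := Finset.mem_Icc.2 ⟨by omega, by omega⟩
  have hknot : k ∉ Finset.Icc 1 (k - 1) := by rw [Finset.mem_Icc]; omega
  have hP : ∀ i, ∀ u ∈ P i, ∀ v ∈ P i, ¬ G.Adj u v := fun i u hu v hv huv =>
    hindep u v huv (((hmem u i).1 hu).trans ((hmem v i).1 hv).symm)
  have hadj : ∀ i ∈ Finset.Icc 1 (k - 1), ∀ j ∈ Finset.Icc 1 (k - 1), i ≠ j →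
      ∀ u ∈ P i, ∀ v ∈ P j, G.Adj u v := by
    intro i hi j hj hij u hu v hv
    rw [hmem] at hu hv
    rw [Finset.mem_Icc] at hi hj
    by_contra huv
    rcases hlast u v (by omega) huv with h | h <;> omega
  have hj : ∀ v ∈ P k, ∀ i ∈ Finset.Icc 1 (k - 1), ∀ u ∈ P i, ¬ G.Adj v u →
      i = f v ∧ (P i).card = (P (k - 1)).card := by
    intro v hv i hi u hu huv
    rw [hmem] at hu hv
    have h := hf u v (by rintro h; rw [hu, hv] at h; exact hknot (h ▸ hi))
      (fun h => huv h.symm) hv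
    rw [hu] at h
    refine ⟨h.2.2, ?_⟩
    zify
    rw [hPcard i (hsub i hi), hPcard (k - 1) hk1, h.2.1]
  have huniv : Finset.univ = P k ∪ U := by
    ext v
    have := Finset.mem_Icc.1 (hc v)
    simp only [Finset.mem_univ, Finset.mem_union, hU, Finset.mem_biUnion, hmem,
      exists_eq_right', Finset.mem_Icc, true_iff]
    omega
  have hdisj : Disjoint (P k) U := by
    rw [Finset.disjoint_left]
    intro v hv hv'
    obtain ⟨i, hi, hv'⟩ := Finset.mem_biUnion.1 hv'
    rw [hmem] at hv hv'
    exact hknot (hv.symm.trans hv' ▸ hi)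
  have key : ∀ s, (NK G (s + 2) : ℤ) = esymmOn (Finset.Icc 1 k) (fun i => (sz i : ℤ)) (s + 2) -
      (∑ v ∈ P k, (U.filter (¬ G.Adj v ·)).card : ℕ) *
        esymmOn (Finset.Icc 1 (k - 2)) (fun i => (sz i : ℤ)) s := by
    intro s
    rw [NK_eq_cliqueCount, huniv, cliqueCount_union_of_indep G hdisj (hP k) (s + 1)]
    push_cast
    have hnbr : ∀ v ∈ P k, (cliqueCount G (U.filter (G.Adj v)) (s + 1) : ℤ) =
        esymmOn (Finset.Icc 1 (k - 1)) (fun i => ((P i).card : ℤ)) (s + 1) -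
          (U.filter (¬ G.Adj v ·)).card *
            esymmOn (Finset.Icc 1 (k - 2)) (fun i => ((P i).card : ℤ)) s := fun v hv => by
      convert! cliqueCount_neighbors hk (fun i _ => hP i) hadj (hj v hv) s
    rw [Finset.sum_congr rfl hnbr, Finset.sum_sub_distrib,
      ← Finset.sum_mul, Finset.sum_const, nsmul_eq_mul, hU,
      cliqueCount_multipartite G _ P (fun i _ => hP i) hadj, natCast_esymmOn,
      esymmOn_congr fun i hi => hPcard i (hsub i hi),
      esymmOn_congr fun i hi => hPcard i (hsub i hi),
      esymmOn_congr fun i hi => hPcard i (hsub' i hi), hPcard k hkk,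
      ← insert_Icc_pred (by omega : 1 ≤ k), esymmOn_insert_succ hknot]
    ring
  have h2 := key 0
  rw [Nat.zero_add, NK_two, esymmOn_zero, mul_one] at h2
  rw [key, h2]
  ring

theorem NK_of_MemH2star {e : ℕ} (hn : 0 < n) (hk : 3 ≤ kk n e) (he : e ≤ n.choose 2)
    (hG : MemH2star n e G) (r : ℕ) :
    (NK G (r + 2) : ℤ) = esymmOn (Finset.Icc 1 (kk n e)) (fun i => (aStar n e i : ℤ)) (r + 2) -
      mStar n e * esymmOn (Finset.Icc 1 (kk n e - 2)) (fun i => (aStar n e i : ℤ)) r := by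
  rcases hG with hG | ⟨hcard, c, sz, f, hsz, hc, hcsz, hindep, hf, hlast⟩
  · exact NK_of_MemH1star hn (by omega) he hG.1 r
  have hm := congrArg (Nat.cast : ℕ → ℤ) (add_mStar hn (by omega) he)
  rw [natCast_esymmOn, Nat.cast_add] at hm
  rw [NK_of_multipartite_delete (by omega) hc hcsz hindep hf hlast, hcard]
  generalize kk n e = k at *
  rcases hsz with hsz | ⟨hm0, hge, hsz, hsz1, hsz2⟩
  · simp only [hsz]
    rw [← hm]
    ring
  · have h1 : Finset.Icc 1 k = insert (k - 1) (insert k (Finset.Icc 1 (k - 2))) := by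
      ext i; simp only [Finset.mem_insert, Finset.mem_Icc]; omega
    have h2 : Finset.Icc 1 k = insert 1 (insert k (Finset.Icc 2 (k - 1))) := by
      ext i; simp only [Finset.mem_insert, Finset.mem_Icc]; omega
    have h3 : ∀ s, esymmOn (Finset.Icc 1 (k - 2)) (fun i => (sz i : ℤ)) s =
        esymmOn (Finset.Icc 2 (k - 1)) (fun i => (aStar n e i : ℤ)) s := fun s => by
      have hR : Finset.Icc 2 (k - 1) = (Finset.Icc 1 (k - 2)).map (addRightEmbedding 1) := by
        rw [Finset.map_add_right_Icc]
        congr 1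
        omega
      rw [hR, esymmOn_map]
      exact esymmOn_congr (fun i hi => by rw [hsz i hi]; rfl) s
    have ha : ((aStar n e 1 - 1 : ℕ) : ℤ) = aStar n e 1 - 1 := by
      rw [Nat.cast_sub (by omega), Nat.cast_one]
    have hsz_sum : ∀ s, esymmOn (Finset.Icc 1 k) (fun i => (sz i : ℤ)) (s + 2) =
        esymmOn (Finset.Icc 1 k) (fun i => (aStar n e i : ℤ)) (s + 2) +
          (aStar n e 1 - aStar n e k - 1) *
            esymmOn (Finset.Icc 2 (k - 1)) (fun i => (aStar n e i : ℤ)) s := fun s => by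
      rw [h1, esymmOn_insert_insert (by rw [Finset.mem_Icc]; omega)
        (by rw [Finset.mem_Icc]; omega) (by omega), ← h1, h2, esymmOn_insert_insert (by simp)
        (by rw [Finset.mem_Icc]; omega) (by omega), h3, h3, h3, hsz1, hsz2, ha]
      push_cast
      ring
    have hsz_two := hsz_sum 0
    rw [Nat.zero_add, esymmOn_zero, mul_one, ← hm, hm0] at hsz_two
    rw [hsz_sum, h3, hsz_two, hm0]
    push_cast
    ring

end Families

/-- For `n ≥ r ≥ 4` and `t_{r-1}(n) < e ≤ C(n,2)`, every graph in
`H_2*(n,e)` has exactly `h_r*(n,e)` cliques of size `r`. -/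
theorem cliques_of_H2star (n e r : ℕ) (hrn : r ≤ n) (hr : 4 ≤ r)
    (he1 : tur (r - 1) n < e) (he2 : e ≤ n.choose 2) :
    ∀ G : SimpleGraph (Fin n), MemH2star n e G → (NK G r : ℤ) = hStar n e r := by
  intro G hG
  obtain ⟨r, rfl⟩ : ∃ s, r = s + 2 := ⟨r - 2, by omega⟩
  have hk := lt_kk he1 he2
  exact NK_of_MemH2star (by omega) (by omega) he2 hG r
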